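/- Let Ω⁺ ⊂ ℝ³ be a bounded open set with Lipschitz boundary, let Ω⁻ be a minimizer of the unconstrained problem min{ E(Ω⁻) : Ω⁻ measurable, |Ω⁺ ∩ Ω⁻| = 0, |Ω⁻| < ∞ }, and let φ be the associated potential. Then φ(x) ≥ 0 for all x ∈ ℝ³ and φ = 0 almost everywhere in ℝ³ \ (Ω⁺ ∪ Ω⁻) (complete screening). -/

import Mathlib

open MeasureTheory Real
open scoped RealInnerProductSpace

noncomputable section

abbrev E3 := EuclideanSpace ℝ (Fin 3)

/-- The Coulomb kernel in ℝ³. -/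
def coul (x y : E3) : ℝ := 1 / (4 * π * ‖x - y‖)

/-- The Coulomb energy `E(Ω⁻)`. -/
def energy (Ωp Ωm : Set E3) : ℝ :=
  (∫ x in Ωp, ∫ y in Ωp, coul x y) + (∫ x in Ωm, ∫ y in Ωm, coul x y)
    - 2 * ∫ x in Ωp, ∫ y in Ωm, coul x y

/-- Admissible configurations for the unconstrained problem. -/
def Adm (Ωp Ωm : Set E3) : Prop :=
  MeasurableSet Ωm ∧ volume (Ωp ∩ Ωm) = 0 ∧ volume Ωm < ⊤

/-- The potential `φ` generated by the charges `χ_{Ω⁺} − χ_{Ω⁻}`. -/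
def potential (Ωp Ωm : Set E3) (x : E3) : ℝ :=
  ∫ y, (Set.indicator Ωp (fun _ => (1:ℝ)) y - Set.indicator Ωm (fun _ => (1:ℝ)) y) * coul x y

/-- A bounded open set has Lipschitz boundary if near each boundary point, after
choosing a unit direction `ν`, the set is the region above the graph of a
Lipschitz function over the hyperplane orthogonal to `ν`. -/
def HasLipschitzBoundary (Ω : Set E3) : Prop :=
  ∀ x ∈ frontier Ω, ∃ (ν : E3) (ψ : E3 → ℝ) (K : NNReal) (r : ℝ),
    ‖ν‖ = 1 ∧ LipschitzWith K ψ ∧ 0 < r ∧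
    ∀ (v : E3) (t : ℝ), ⟪v, ν⟫ = 0 → x + v + t • ν ∈ Metric.ball x r →
      (x + v + t • ν ∈ Ω ↔ ψ v < t)

open Set Filter Topology Metric

lemma coul_nonneg (x y : E3) : 0 ≤ coul x y := by unfold coul; positivity

lemma coul_comm (x y : E3) : coul x y = coul y x := by unfold coul; rw [norm_sub_rev]

lemma measurable_coul : Measurable (Function.uncurry coul) := by
  unfold coul Function.uncurry
  fun_prop

lemma measurable_coul_right (x : E3) : Measurable (coul x) := by
  unfold coul
  fun_prop

lemma coul_le {r : ℝ} (hr : 0 < r) {x y : E3} (h : r ≤ ‖x - y‖) : coul x y ≤ 1 / (4 * π * r) := by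
  unfold coul
  gcongr

lemma coul_zero (y : E3) : coul 0 y = (fun s : ℝ => 1 / (4 * π * s)) ‖y‖ := by
  simp [coul]

lemma coul_sub (x y : E3) : coul x y = coul 0 (y - x) := by
  simp [coul, norm_sub_rev x y]

lemma integrableOn_coul_zero_ball (r : ℝ) : IntegrableOn (coul 0) (ball 0 r) := by
  have h := (integrableOn_fun_norm_addHaar (volume : Measure E3)
    (f := fun s : ℝ => 1 / (4 * π * s)) (r := r)).2
  refine (h ?_).congr_fun (fun y _ => (coul_zero y).symm) measurableSet_ball
  have hc : IntegrableOn (fun y : ℝ => y / (4 * π)) (Ioo 0 r) :=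
    (ContinuousOn.integrableOn_Icc (by fun_prop)).mono_set Ioo_subset_Icc_self
  refine hc.congr_fun (fun y hy => ?_) measurableSet_Ioo
  have := hy.1.ne'
  simp
  field_simp

lemma preimage_sub_ball (x : E3) (r : ℝ) : (fun y => y - x) ⁻¹' ball 0 r = ball x r := by
  ext y; simp [dist_eq_norm]

lemma integrableOn_coul_ball (x : E3) (r : ℝ) : IntegrableOn (coul x) (ball x r) := by
  have h := (measurePreserving_sub_right (volume : Measure E3) x).integrableOn_comp_preimage
    (MeasurableEquiv.subRight x).measurableEmbedding (f := coul 0) (s := ball 0 r)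
  rw [preimage_sub_ball] at h
  exact (h.2 (integrableOn_coul_zero_ball r)).congr_fun (fun y _ => (coul_sub x y).symm)
    measurableSet_ball

lemma setIntegral_coul_ball (x : E3) {r : ℝ} (hr : 0 ≤ r) :
    ∫ y in ball x r, coul x y = r ^ 2 / 2 := by
  have h := (measurePreserving_sub_right (volume : Measure E3) x).setIntegral_preimage_emb
    (MeasurableEquiv.subRight x).measurableEmbedding (coul 0) (ball 0 r)
  rw [preimage_sub_ball] at h
  simp_rw [coul_sub x, h]
  have h2 : ∀ y : E3, (ball (0 : E3) r).indicator (coul 0) y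
      = (fun s => (Iio r).indicator (fun s : ℝ => 1 / (4 * π * s)) s) ‖y‖ := by
    intro y
    by_cases hy : ‖y‖ < r <;> simp [hy, coul_zero]
  rw [← integral_indicator measurableSet_ball, funext h2, integral_fun_norm_addHaar]
  have h3 : ∫ y in Ioi (0 : ℝ), y ^ (Module.finrank ℝ E3 - 1) •
      (Iio r).indicator (fun s : ℝ => 1 / (4 * π * s)) y = ∫ y in (0 : ℝ)..r, y / (4 * π) := by
    rw [intervalIntegral.integral_of_le hr, integral_Ioc_eq_integral_Ioo,
      ← integral_indicator measurableSet_Ioi, ← integral_indicator measurableSet_Ioo]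
    congr 1
    ext s
    by_cases h0 : 0 < s
    · by_cases h1 : s < r
      · simp [h0, h1]
        field_simp
      · simp [h1]
    · simp [h0]
  rw [h3, Measure.real, EuclideanSpace.volume_ball_fin_three]
  simp
  rw [ENNReal.toReal_ofReal (by positivity)]
  field_simp

/-- A density bounded by one that is integrable. -/
structure IsDensity (ρ : E3 → ℝ) : Prop where
  integrable : Integrable ρ
  abs_le_one : ∀ y, |ρ y| ≤ 1

/-- The Coulomb kernel regularised at scale `ε`. -/
def softCoul (ε : ℝ) (x y : E3) : ℝ := 1 / (4 * π * √(‖x - y‖ ^ 2 + ε ^ 2))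

/-- The Coulomb potential of a charge density. -/
def chargePot (ρ : E3 → ℝ) (x : E3) : ℝ := ∫ y, ρ y * coul x y

/-- The regularised Coulomb potential of a charge density. -/
def softPot (ε : ℝ) (ρ : E3 → ℝ) (x : E3) : ℝ := ∫ y, ρ y * softCoul ε x y

lemma integrable_indicator_ball (x : E3) (r : ℝ) :
    Integrable ((ball x r).indicator (coul x)) :=
  (integrable_indicator_iff measurableSet_ball).2 (integrableOn_coul_ball x r)

section Density

variable {ρ : E3 → ℝ}

lemma IsDensity.abs_mul_coul_le (hρ : IsDensity ρ) {r : ℝ} (hr : 0 < r) (x y : E3) :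
    |ρ y * coul x y| ≤ (ball x r).indicator (coul x) y + |ρ y| * (1 / (4 * π * r)) := by
  rw [abs_mul, abs_of_nonneg (coul_nonneg x y)]
  by_cases hy : y ∈ ball x r
  · rw [indicator_of_mem hy]
    have := mul_le_mul_of_nonneg_right (hρ.abs_le_one y) (coul_nonneg x y)
    have : 0 ≤ |ρ y| * (1 / (4 * π * r)) := by positivity
    linarith
  · rw [indicator_of_notMem hy, zero_add]
    gcongr
    exact coul_le hr (by simpa [dist_eq_norm, norm_sub_rev] using hy)

lemma IsDensity.integrable_mul_coul (hρ : IsDensity ρ) (x : E3) :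
    Integrable (fun y => ρ y * coul x y) :=
  ((integrable_indicator_ball x 1).add (hρ.integrable.abs.mul_const _)).mono'
    (hρ.integrable.aestronglyMeasurable.mul (measurable_coul_right x).aestronglyMeasurable)
    (Eventually.of_forall fun y => hρ.abs_mul_coul_le one_pos x y)

lemma IsDensity.abs_chargePot_le (hρ : IsDensity ρ) {r : ℝ} (hr : 0 < r) (x : E3) :
    |chargePot ρ x| ≤ r ^ 2 / 2 + (∫ y, |ρ y|) * (1 / (4 * π * r)) := by
  unfold chargePot
  refine (abs_integral_le_integral_abs).trans ?_
  rw [← setIntegral_coul_ball x hr.le, ← integral_indicator measurableSet_ball,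
    ← integral_mul_const,
    ← integral_add (integrable_indicator_ball x r) (hρ.integrable.abs.mul_const _)]
  exact integral_mono (hρ.integrable_mul_coul x).abs
    ((integrable_indicator_ball x r).add (hρ.integrable.abs.mul_const _))
    (fun y => hρ.abs_mul_coul_le hr x y)

lemma continuous_softCoul_right {ε : ℝ} (hε : 0 < ε) (x : E3) : Continuous (softCoul ε x) := by
  unfold softCoul
  refine continuous_const.div (by fun_prop) fun p => ?_
  positivity

lemma continuous_softCoul_left {ε : ℝ} (hε : 0 < ε) (y : E3) :
    Continuous (fun x => softCoul ε x y) := by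
  unfold softCoul
  refine continuous_const.div (by fun_prop) fun p => ?_
  positivity

lemma softCoul_nonneg (ε : ℝ) (x y : E3) : 0 ≤ softCoul ε x y := by unfold softCoul; positivity

lemma softCoul_le {ε : ℝ} (hε : 0 < ε) (x y : E3) : softCoul ε x y ≤ 1 / (4 * π * ε) := by
  unfold softCoul
  gcongr
  exact Real.le_sqrt_of_sq_le (by nlinarith [sq_nonneg ‖x - y‖])

lemma IsDensity.integrable_mul_softCoul (hρ : IsDensity ρ) {ε : ℝ} (hε : 0 < ε) (x : E3) :
    Integrable (fun y => ρ y * softCoul ε x y) := by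
  refine hρ.integrable.mul_bdd (c := 1 / (4 * π * ε)) ?_ (Eventually.of_forall fun y => ?_)
  · exact (continuous_softCoul_right hε x).aestronglyMeasurable
  · rw [Real.norm_of_nonneg (softCoul_nonneg ε x y)]
    exact softCoul_le hε x y

lemma IsDensity.continuous_softPot (hρ : IsDensity ρ) {ε : ℝ} (hε : 0 < ε) :
    Continuous (softPot ε ρ) := by
  refine continuous_of_dominated (bound := fun y => |ρ y| * (1 / (4 * π * ε)))
    (fun x => (hρ.integrable_mul_softCoul hε x).aestronglyMeasurable)
    (fun x => Eventually.of_forall fun y => ?_) (hρ.integrable.abs.mul_const _)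
    (Eventually.of_forall fun y => ?_)
  · rw [norm_mul, Real.norm_of_nonneg (softCoul_nonneg ε x y), Real.norm_eq_abs]
    gcongr
    exact softCoul_le hε x y
  · exact continuous_const.mul (continuous_softCoul_left hε y)

lemma IsDensity.tendsto_softPot (hρ : IsDensity ρ) {ε : ℝ} (hε : 0 < ε) :
    Tendsto (softPot ε ρ) (comap norm atTop) (𝓝 0) := by
  have h0 : (0 : ℝ) = ∫ _y : E3, (0 : ℝ) := by simp
  rw [h0]
  refine tendsto_integral_filter_of_dominated_convergence (fun y => |ρ y| * (1 / (4 * π * ε)))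
    (Eventually.of_forall fun x => (hρ.integrable_mul_softCoul hε x).aestronglyMeasurable)
    (Eventually.of_forall fun x => Eventually.of_forall fun y => ?_) (hρ.integrable.abs.mul_const _)
    (Eventually.of_forall fun y => ?_)
  · rw [norm_mul, Real.norm_of_nonneg (softCoul_nonneg ε x y), Real.norm_eq_abs]
    gcongr
    exact softCoul_le hε x y
  · rw [← mul_zero (ρ y)]
    refine Tendsto.const_mul _ ?_
    unfold softCoul
    refine tendsto_const_nhds.div_atTop (Tendsto.const_mul_atTop (by positivity) ?_)
    refine tendsto_atTop_mono (f := fun x : E3 => ‖x‖ - ‖y‖) (fun x => ?_) ?_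
    · refine (norm_sub_norm_le x y).trans (Real.le_sqrt_of_sq_le ?_)
      nlinarith [sq_nonneg ε]
    · exact tendsto_atTop_add_const_right _ _ tendsto_comap

lemma abs_coul_sub_softCoul_le {ε r : ℝ} (hε : 0 < ε) (hr : 0 < r) {x y : E3} (hxy : x ≠ y) :
    |coul x y - softCoul ε x y| ≤ coul x y ∧
      (r ≤ ‖x - y‖ → |coul x y - softCoul ε x y| ≤ ε / (4 * π * r ^ 2)) := by
  have h0 : 0 < ‖x - y‖ := norm_pos_iff.2 (sub_ne_zero.2 hxy)
  set d := ‖x - y‖ with hd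
  set σ := √(d ^ 2 + ε ^ 2) with hσ
  have h1 : d ≤ σ := Real.le_sqrt_of_sq_le (by nlinarith [sq_nonneg ε])
  have h2 : σ ≤ d + ε := by
    rw [hσ, Real.sqrt_le_left (by positivity)]
    nlinarith
  have h3 : softCoul ε x y ≤ coul x y := by
    unfold softCoul coul
    rw [← hd, ← hσ]
    gcongr
  rw [abs_of_nonneg (sub_nonneg.2 h3)]
  refine ⟨by linarith [softCoul_nonneg ε x y], fun hrd => ?_⟩
  have hσ0 : 0 < σ := h0.trans_le h1
  have : coul x y - softCoul ε x y = (σ - d) / (4 * π * (d * σ)) := by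
    unfold softCoul coul
    rw [← hd, ← hσ]
    field_simp
  rw [this]
  gcongr
  · linarith
  · nlinarith

lemma IsDensity.abs_chargePot_sub_softPot_le (hρ : IsDensity ρ) {ε r : ℝ} (hε : 0 < ε)
    (hr : 0 < r) (x : E3) :
    |chargePot ρ x - softPot ε ρ x| ≤ r ^ 2 / 2 + (∫ y, |ρ y|) * (ε / (4 * π * r ^ 2)) := by
  unfold chargePot softPot
  rw [← integral_sub (hρ.integrable_mul_coul x) (hρ.integrable_mul_softCoul hε x)]
  refine (abs_integral_le_integral_abs).trans ?_
  rw [← setIntegral_coul_ball x hr.le, ← integral_indicator measurableSet_ball,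
    ← integral_mul_const,
    ← integral_add (integrable_indicator_ball x r) (hρ.integrable.abs.mul_const _)]
  refine integral_mono_ae
    ((hρ.integrable_mul_coul x).sub (hρ.integrable_mul_softCoul hε x)).abs
    ((integrable_indicator_ball x r).add (hρ.integrable.abs.mul_const _)) ?_
  filter_upwards [compl_mem_ae_iff.2 (measure_singleton x)] with y hy
  obtain ⟨h1, h2⟩ := abs_coul_sub_softCoul_le hε hr (x := x) (y := y) (fun h => hy h.symm)
  simp only [← mul_sub, abs_mul]
  by_cases hb : y ∈ ball x r
  · rw [indicator_of_mem hb]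
    have h3 : |ρ y| * |coul x y - softCoul ε x y| ≤ 1 * coul x y := by
      gcongr
      exact hρ.abs_le_one y
    have : 0 ≤ |ρ y| * (ε / (4 * π * r ^ 2)) := by positivity
    linarith
  · rw [indicator_of_notMem hb, zero_add]
    gcongr
    exact h2 (by simpa [dist_eq_norm, norm_sub_rev] using hb)

lemma IsDensity.exists_softPot_approx (hρ : IsDensity ρ) {c : ℝ} (hc : 0 < c) :
    ∃ ε₀ > 0, ∀ ε, 0 < ε → ε ≤ ε₀ → ∀ x, |chargePot ρ x - softPot ε ρ x| ≤ c := by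
  have hM : 0 ≤ ∫ y, |ρ y| := integral_nonneg fun y => abs_nonneg _
  refine ⟨2 * π * c ^ 2 / ((∫ y, |ρ y|) + 1), by positivity, fun ε hε hle x => ?_⟩
  refine (hρ.abs_chargePot_sub_softPot_le hε (Real.sqrt_pos.2 hc) x).trans ?_
  rw [Real.sq_sqrt hc.le]
  rw [le_div_iff₀ (by positivity)] at hle
  have : (∫ y, |ρ y|) * (ε / (4 * π * c)) ≤ c / 2 := by
    rw [mul_div_assoc', div_le_div_iff₀ (by positivity) (by positivity)]
    nlinarith
  linarith

lemma IsDensity.continuous_chargePot (hρ : IsDensity ρ) : Continuous (chargePot ρ) := by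
  refine continuous_of_uniform_approx_of_continuous fun u hu => ?_
  obtain ⟨c, hc, hcu⟩ := Metric.mem_uniformity_dist.1 hu
  obtain ⟨ε, hε, h⟩ := hρ.exists_softPot_approx (half_pos hc)
  refine ⟨softPot ε ρ, hρ.continuous_softPot hε, fun x => hcu ?_⟩
  rw [Real.dist_eq]
  linarith [h ε hε le_rfl x]

lemma IsDensity.exists_abs_chargePot_lt (hρ : IsDensity ρ) {c : ℝ} (hc : 0 < c) :
    ∃ R : ℝ, 0 < R ∧ ∀ x, R ≤ ‖x‖ → |chargePot ρ x| < c := by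
  obtain ⟨ε, hε, h⟩ := hρ.exists_softPot_approx (half_pos hc)
  have h1 := (hρ.tendsto_softPot hε).eventually (Metric.ball_mem_nhds 0 (half_pos hc))
  rw [eventually_comap] at h1
  obtain ⟨R, hR⟩ := eventually_atTop.1 h1
  refine ⟨max R 1, by positivity, fun x hx => ?_⟩
  have h2 := hR ‖x‖ ((le_max_left _ _).trans hx) x rfl
  rw [dist_zero_right, Real.norm_eq_abs] at h2
  have h3 := h ε hε le_rfl x
  have h4 := abs_sub_abs_le_abs_sub (chargePot ρ x) (softPot ε ρ x)
  linarith

lemma abs_inv_sqrt_one_add_sub_le {u : ℝ} (hu : |u| ≤ 1 / 2) :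
    |1 / √(1 + u) - (1 - u / 2 + 3 * u ^ 2 / 8)| ≤ |u| ^ 3 := by
  obtain ⟨h1, h2⟩ := abs_le.1 hu
  have hpos : 0 < 1 + u := by linarith
  set w := √(1 + u) with hw
  have hw0 : 0 < w := Real.sqrt_pos.2 hpos
  have hw2 : w ^ 2 = 1 + u := Real.sq_sqrt hpos.le
  have key : ∀ p : ℝ, 0 ≤ p → 1 ≤ p ^ 2 * (1 + u) → 1 / w ≤ p := fun p hp h => by
    rw [div_le_iff₀ hw0]
    rw [← hw2, ← mul_pow] at h
    exact (one_le_sq_iff₀ (by positivity)).1 h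
  have key' : ∀ p : ℝ, 0 ≤ p → p ^ 2 * (1 + u) ≤ 1 → p ≤ 1 / w := fun p hp h => by
    rw [le_div_iff₀ hw0]
    rw [← hw2, ← mul_pow] at h
    exact (sq_le_one_iff₀ (by positivity)).1 h
  have hq : |u| ^ 3 ≤ 1 / 8 := by
    calc |u| ^ 3 ≤ (1 / 2) ^ 3 := by gcongr
      _ = 1 / 8 := by norm_num
  have hq0 : 0 ≤ |u| ^ 3 := by positivity
  have hlow : 0 ≤ 1 - u / 2 + 3 * u ^ 2 / 8 - |u| ^ 3 := by nlinarith
  suffices (1 - u / 2 + 3 * u ^ 2 / 8 - |u| ^ 3) ^ 2 * (1 + u) ≤ 1 ∧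
      1 ≤ (1 - u / 2 + 3 * u ^ 2 / 8 + |u| ^ 3) ^ 2 * (1 + u) by
    have h3 := key' _ hlow this.1
    have h4 := key _ (by linarith) this.2
    rw [abs_le]
    constructor <;> linarith
  rcases le_or_gt 0 u with hs | hs
  · rw [abs_of_nonneg hs] at hq hq0 ⊢
    constructor
    · have hB : 0 ≤ (1 + u) * (2 - u + 3 * u ^ 2 / 4 - u ^ 3) - 5 / 8 + 15 * u / 64
          - 9 * u ^ 2 / 64 := by nlinarith
      nlinarith [mul_nonneg hq0 hB]
    · have hB : 0 ≤ (1 + u) * (2 - u + 3 * u ^ 2 / 4 + u ^ 3) + 5 / 8 - 15 * u / 64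
          + 9 * u ^ 2 / 64 := by nlinarith
      nlinarith [mul_nonneg hq0 hB]
  · rw [abs_of_neg hs] at hq hq0 ⊢
    constructor
    · have hB : 0 ≤ (1 + u) * (2 - u + 3 * u ^ 2 / 4 + u ^ 3) + 5 / 8 - 15 * u / 64
          + 9 * u ^ 2 / 64 := by nlinarith
      nlinarith [mul_nonneg hq0 hB]
    · have hB : 0 ≤ (1 + u) * (2 - u + 3 * u ^ 2 / 4 - u ^ 3) - 5 / 8 + 15 * u / 64
          - 9 * u ^ 2 / 64 := by nlinarith
      nlinarith [mul_nonneg hq0 hB]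

lemma abs_inv_sqrt_add_sub_le {σ h : ℝ} (hσ : 0 < σ) (hh : |h / σ ^ 2| ≤ 1 / 2) :
    |1 / √(σ ^ 2 + h) - 1 / σ * (1 - h / σ ^ 2 / 2 + 3 * (h / σ ^ 2) ^ 2 / 8)|
      ≤ 1 / σ * |h / σ ^ 2| ^ 3 := by
  have h1 : σ ^ 2 + h = σ ^ 2 * (1 + h / σ ^ 2) := by field_simp
  rw [h1, Real.sqrt_mul (by positivity), Real.sqrt_sq hσ.le, ← one_div_mul_one_div,
    ← mul_sub, abs_mul, abs_of_pos (by positivity : 0 < 1 / σ)]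
  gcongr
  exact abs_inv_sqrt_one_add_sub_le hh

/-- The symmetric second difference of `f` at `x` with step `t`, summed over the coordinate
directions. -/
def secondDiff (t : ℝ) (f : E3 → ℝ) (x : E3) : ℝ :=
  ∑ i : Fin 3, (f (x + EuclideanSpace.single i t) + f (x - EuclideanSpace.single i t) - 2 * f x)

lemma norm_add_single_sq (z : E3) (i : Fin 3) (t : ℝ) :
    ‖z + EuclideanSpace.single i t‖ ^ 2 = ‖z‖ ^ 2 + (2 * t * z i + t ^ 2) := by
  rw [norm_add_sq_real, EuclideanSpace.inner_single_right, PiLp.norm_single]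
  simp
  ring

lemma norm_sub_single_sq (z : E3) (i : Fin 3) (t : ℝ) :
    ‖z - EuclideanSpace.single i t‖ ^ 2 = ‖z‖ ^ 2 + (-(2 * t * z i) + t ^ 2) := by
  rw [norm_sub_sq_real, EuclideanSpace.inner_single_right, PiLp.norm_single]
  simp
  ring

lemma secondDiff_norm_sq (t : ℝ) (x : E3) : secondDiff t (fun x => ‖x‖ ^ 2) x = 6 * t ^ 2 := by
  unfold secondDiff
  simp only [norm_add_single_sq, norm_sub_single_sq, Fin.sum_univ_three]
  ring

lemma abs_secondDiff_softCoul_add_le {ε t : ℝ} (ht : 0 < t) (htε : 6 * t ≤ ε) (x y : E3) :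
    |4 * π * secondDiff t (fun x => softCoul ε x y) x
      + 3 * t ^ 2 * ε ^ 2 / √(‖x - y‖ ^ 2 + ε ^ 2) ^ 5| ≤ 165 * t ^ 3 / ε ^ 4 := by
  have hε : 0 < ε := by linarith
  set z := x - y with hz
  set σ := √(‖z‖ ^ 2 + ε ^ 2) with hσ
  have hσ2 : σ ^ 2 = ‖z‖ ^ 2 + ε ^ 2 := Real.sq_sqrt (by positivity)
  have hεσ : ε ≤ σ := Real.le_sqrt_of_sq_le (by nlinarith [sq_nonneg ‖z‖])
  have hσ0 : 0 < σ := hε.trans_le hεσ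
  have hzσ : ‖z‖ ≤ σ := Real.le_sqrt_of_sq_le (by nlinarith [sq_nonneg ε])
  have hsum : ‖z‖ ^ 2 = z 0 ^ 2 + z 1 ^ 2 + z 2 ^ 2 := by
    rw [EuclideanSpace.real_norm_sq_eq, Fin.sum_univ_three]
  have hstep : ∀ h : ℝ, |h| ≤ 2 * t * σ + t ^ 2 →
      |1 / √(σ ^ 2 + h) - 1 / σ * (1 - h / σ ^ 2 / 2 + 3 * (h / σ ^ 2) ^ 2 / 8)|
        ≤ 27 * t ^ 3 / ε ^ 4 := by
    intro h hh
    have h1 : |h / σ ^ 2| ≤ 3 * t / ε := by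
      rw [abs_div, abs_of_pos (by positivity : 0 < σ ^ 2),
        div_le_div_iff₀ (by positivity) hε]
      calc |h| * ε ≤ (2 * t * σ + t ^ 2) * ε := by gcongr
        _ ≤ (2 * t * σ + t * σ) * σ := by
          gcongr
          nlinarith
        _ = 3 * t * σ ^ 2 := by ring
    have h2 : 3 * t / ε ≤ 1 / 2 := by
      rw [div_le_div_iff₀ hε (by norm_num)]
      linarith
    refine (abs_inv_sqrt_add_sub_le hσ0 (h1.trans h2)).trans ?_
    calc 1 / σ * |h / σ ^ 2| ^ 3 ≤ 1 / ε * (3 * t / ε) ^ 3 := by gcongr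
      _ = 27 * t ^ 3 / ε ^ 4 := by field_simp; norm_num
  have hcoord : ∀ i, |2 * t * z i| ≤ 2 * t * σ := fun i => by
    rw [abs_mul, abs_of_pos (by positivity : 0 < 2 * t)]
    gcongr
    exact (PiLp.norm_apply_le z i).trans hzσ
  have hplus : ∀ i, |2 * t * z i + t ^ 2| ≤ 2 * t * σ + t ^ 2 := fun i =>
    (abs_add_le _ _).trans (by rw [abs_of_nonneg (sq_nonneg t)]; linarith [hcoord i])
  have hminus : ∀ i, |-(2 * t * z i) + t ^ 2| ≤ 2 * t * σ + t ^ 2 := fun i =>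
    (abs_add_le _ _).trans (by rw [abs_of_nonneg (sq_nonneg t), abs_neg]; linarith [hcoord i])
  have hD : 4 * π * secondDiff t (fun x => softCoul ε x y) x
      = ∑ i : Fin 3, (1 / √(σ ^ 2 + (2 * t * z i + t ^ 2))
        + 1 / √(σ ^ 2 + (-(2 * t * z i) + t ^ 2)) - 2 * (1 / σ)) := by
    unfold secondDiff softCoul
    rw [Finset.mul_sum]
    refine Finset.sum_congr rfl fun i _ => ?_
    have e1 : x + EuclideanSpace.single i t - y = z + EuclideanSpace.single i t := by
      rw [hz]; abel
    have e2 : x - EuclideanSpace.single i t - y = z - EuclideanSpace.single i t := by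
      rw [hz]; abel
    simp only [e1, e2, ← hz, norm_add_single_sq, norm_sub_single_sq, ← hσ]
    rw [add_right_comm (‖z‖ ^ 2) _ (ε ^ 2), add_right_comm (‖z‖ ^ 2) _ (ε ^ 2), ← hσ2]
    simp only [one_div, mul_inv]
    field_simp
  have hmain : ∑ i : Fin 3,
      (1 / σ * (1 - (2 * t * z i + t ^ 2) / σ ^ 2 / 2 + 3 * ((2 * t * z i + t ^ 2) / σ ^ 2) ^ 2 / 8)
      + 1 / σ * (1 - (-(2 * t * z i) + t ^ 2) / σ ^ 2 / 2
        + 3 * ((-(2 * t * z i) + t ^ 2) / σ ^ 2) ^ 2 / 8) - 2 * (1 / σ))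
      = -(3 * t ^ 2 * ε ^ 2 / σ ^ 5) + 9 / 4 * t ^ 4 / σ ^ 5 := by
    have : ε ^ 2 = σ ^ 2 - (z 0 ^ 2 + z 1 ^ 2 + z 2 ^ 2) := by rw [hσ2, hsum]; ring
    rw [this, Fin.sum_univ_three]
    field_simp
    ring
  have hrest : 9 / 4 * t ^ 4 / σ ^ 5 ≤ 3 * t ^ 3 / ε ^ 4 := by
    calc 9 / 4 * t ^ 4 / σ ^ 5 ≤ 9 / 4 * t ^ 4 / ε ^ 5 := by gcongr
      _ ≤ 3 * t ^ 3 / ε ^ 4 := by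
        rw [div_le_div_iff₀ (by positivity) (by positivity)]
        have : 0 ≤ t ^ 3 * ε ^ 4 * (3 * ε - 9 / 4 * t) :=
          mul_nonneg (by positivity) (by linarith)
        nlinarith
  have hrest0 : 0 ≤ 9 / 4 * t ^ 4 / σ ^ 5 := by positivity
  rw [Fin.sum_univ_three] at hD hmain
  rw [hD, abs_le]
  have hp := fun i => abs_le.1 (hstep _ (hplus i))
  have hm := fun i => abs_le.1 (hstep _ (hminus i))
  have e1 : 165 * t ^ 3 / ε ^ 4 = 6 * (27 * t ^ 3 / ε ^ 4) + 3 * t ^ 3 / ε ^ 4 := by ring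
  rw [e1]
  constructor <;>
  linarith [hp 0, hp 1, hp 2, hm 0, hm 1, hm 2]

lemma IsDensity.secondDiff_softPot (hρ : IsDensity ρ) {ε : ℝ} (hε : 0 < ε) (t : ℝ) (x : E3) :
    Integrable (fun y => ρ y * secondDiff t (fun x => softCoul ε x y) x) ∧
    secondDiff t (softPot ε ρ) x = ∫ y, ρ y * secondDiff t (fun x => softCoul ε x y) x := by
  have hI := fun z => hρ.integrable_mul_softCoul hε z
  have hterm : ∀ i : Fin 3, Integrable (fun y =>
      ρ y * softCoul ε (x + EuclideanSpace.single i t) y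
      + ρ y * softCoul ε (x - EuclideanSpace.single i t) y - 2 * (ρ y * softCoul ε x y)) :=
    fun i => ((hI _).add (hI _)).sub ((hI x).const_mul 2)
  have heq : ∀ y, ρ y * secondDiff t (fun x => softCoul ε x y) x = ∑ i : Fin 3,
      (ρ y * softCoul ε (x + EuclideanSpace.single i t) y
      + ρ y * softCoul ε (x - EuclideanSpace.single i t) y - 2 * (ρ y * softCoul ε x y)) := by
    intro y
    unfold secondDiff
    rw [Finset.mul_sum]
    exact Finset.sum_congr rfl fun i _ => by ring
  simp_rw [heq]
  refine ⟨integrable_finsetSum _ fun i _ => hterm i, ?_⟩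
  rw [integral_finsetSum _ fun i _ => hterm i]
  refine Finset.sum_congr rfl fun i _ => ?_
  rw [integral_sub (f := fun y => ρ y * softCoul ε (x + EuclideanSpace.single i t) y
      + ρ y * softCoul ε (x - EuclideanSpace.single i t) y) ((hI _).add (hI _))
    ((hI x).const_mul 2), integral_add (hI _) (hI _), integral_const_mul]
  rfl

lemma IsDensity.secondDiff_softPot_le (hρ : IsDensity ρ) {ε t δ : ℝ} {x : E3} (ht : 0 < t)
    (htε : 6 * t ≤ ε) (hδ : 0 < δ) (hx : ∀ᵐ y, y ∈ ball x δ → 0 ≤ ρ y) :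
    4 * π * secondDiff t (softPot ε ρ) x
      ≤ (∫ y, |ρ y|) * (165 * t ^ 3 / ε ^ 4 + 3 * t ^ 2 * ε ^ 2 / δ ^ 5) := by
  have hε : 0 < ε := by linarith
  obtain ⟨hint, heq⟩ := hρ.secondDiff_softPot hε t x
  rw [heq, ← integral_const_mul, ← integral_mul_const]
  refine integral_mono_ae (hint.const_mul _) (hρ.integrable.abs.mul_const _) ?_
  filter_upwards [hx] with y hy
  obtain ⟨h1, h2⟩ := abs_le.1 (abs_secondDiff_softCoul_add_le ht htε x y)
  have hm : 0 ≤ 3 * t ^ 2 * ε ^ 2 / √(‖x - y‖ ^ 2 + ε ^ 2) ^ 5 := by positivity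
  have hδ' : 0 ≤ 3 * t ^ 2 * ε ^ 2 / δ ^ 5 := by positivity
  rw [mul_left_comm]
  rcases le_or_gt 0 (ρ y) with h | h
  · rw [abs_of_nonneg h]
    exact mul_le_mul_of_nonneg_left (by linarith) h
  · have hd : δ ≤ ‖x - y‖ := by
      by_contra! hlt
      exact absurd (hy (by rwa [mem_ball, dist_eq_norm, norm_sub_rev])) (by linarith)
    have hmδ : 3 * t ^ 2 * ε ^ 2 / √(‖x - y‖ ^ 2 + ε ^ 2) ^ 5 ≤ 3 * t ^ 2 * ε ^ 2 / δ ^ 5 := by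
      gcongr
      exact hd.trans (Real.le_sqrt_of_sq_le (by nlinarith [sq_nonneg ε]))
    rw [abs_of_neg h]
    nlinarith

/-- Minimum principle: a potential is nonnegative if the charge density is nonnegative wherever
the potential is negative. -/
theorem IsDensity.chargePot_nonneg (hρ : IsDensity ρ)
    (hneg : ∀ᵐ y, chargePot ρ y < 0 → 0 ≤ ρ y) (x : E3) : 0 ≤ chargePot ρ x := by
  by_contra! hx
  set a := -chargePot ρ x with ha
  have ha0 : 0 < a := by linarith
  have hcont := hρ.continuous_chargePot
  obtain ⟨R, hR, hfar⟩ := hρ.exists_abs_chargePot_lt (c := a / 2) (by positivity)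
  obtain ⟨ε₀, hε₀, happ⟩ := hρ.exists_softPot_approx (c := a / 8) (by positivity)
  have hM : 0 ≤ ∫ y, |ρ y| := integral_nonneg fun y => abs_nonneg _
  set M := ∫ y, |ρ y| with hMdef
  have hK : IsCompact (closedBall (0 : E3) R ∩ {z | chargePot ρ z ≤ -(a / 2)}) :=
    (isCompact_closedBall _ _).inter_right (isClosed_le hcont continuous_const)
  obtain ⟨δ, hδ, hKδ⟩ := hK.exists_thickening_subset_open
    (isOpen_lt hcont continuous_const : IsOpen {z | chargePot ρ z < 0})
    (fun z hz => by have := hz.2; simp only [mem_ofPred_eq] at this ⊢; linarith)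
  set η := a / (8 * R ^ 2) with hη
  have hη0 : 0 < η := by positivity
  have hηR : η * R ^ 2 = a / 8 := by rw [hη]; field_simp
  obtain ⟨ε, hε, hεε₀, hεη⟩ : ∃ ε, 0 < ε ∧ ε ≤ ε₀ ∧ M * (3 * ε ^ 2 / δ ^ 5) < η := by
    have hlim : Tendsto (fun ε : ℝ => M * (3 * ε ^ 2 / δ ^ 5)) (𝓝[>] 0) (𝓝 0) := by
      have : Continuous fun ε : ℝ => M * (3 * ε ^ 2 / δ ^ 5) := by fun_prop
      simpa using (this.tendsto 0).mono_left nhdsWithin_le_nhds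
    obtain ⟨ε, h1, h2, h3⟩ := ((hlim.eventually (gt_mem_nhds hη0)).and
      (Ioc_mem_nhdsGT hε₀)).exists
    exact ⟨ε, h2, h3, h1⟩
  have happ' := fun z => abs_le.1 (happ ε hε hεε₀ z)
  have hscont : Continuous fun z => softPot ε ρ z - η * ‖z‖ ^ 2 :=
    (hρ.continuous_softPot hε).sub (by fun_prop)
  obtain ⟨x₁, hx₁, hmin⟩ := (isCompact_closedBall (0 : E3) R).exists_isMinOn
    ⟨0, by simp [hR.le]⟩ hscont.continuousOn
  have hxR : ‖x‖ < R := by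
    by_contra! h
    have := (abs_lt.1 (hfar x h)).1
    linarith
  have hval : chargePot ρ x₁ ≤ -(5 * a / 8) := by
    have h1 : softPot ε ρ x₁ - η * ‖x₁‖ ^ 2 ≤ softPot ε ρ x - η * ‖x‖ ^ 2 :=
      hmin (by simpa using hxR.le)
    have h2 : η * ‖x₁‖ ^ 2 ≤ a / 8 := by
      rw [← hηR]
      gcongr
      simpa using hx₁
    have h3 : 0 ≤ η * ‖x‖ ^ 2 := by positivity
    linarith [(happ' x₁).2, (happ' x).1]
  have hx₁R : ‖x₁‖ < R := by
    by_contra! h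
    have := (abs_lt.1 (hfar x₁ h)).1
    linarith
  have hball : ∀ᵐ y, y ∈ ball x₁ δ → 0 ≤ ρ y := by
    filter_upwards [hneg] with y hy hyb
    refine hy (hKδ (mem_thickening_iff.2 ⟨x₁, ⟨hx₁, ?_⟩, hyb⟩))
    simp only [mem_ofPred_eq]
    linarith
  obtain ⟨t, ht0, htε, htR, htη⟩ : ∃ t, 0 < t ∧ t ≤ ε / 6 ∧ t ≤ R - ‖x₁‖ ∧
      M * (165 * t / ε ^ 4) < η := by
    have hlim : Tendsto (fun t : ℝ => M * (165 * t / ε ^ 4)) (𝓝[>] 0) (𝓝 0) := by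
      have : Continuous fun t : ℝ => M * (165 * t / ε ^ 4) := by fun_prop
      simpa using (this.tendsto 0).mono_left nhdsWithin_le_nhds
    obtain ⟨t, ⟨h1, h2, h3⟩, h4, h5⟩ := ((hlim.eventually (gt_mem_nhds hη0)).and
      (Ioc_mem_nhdsGT (by positivity : 0 < ε / 6)) |>.and
      (Ioc_mem_nhdsGT (sub_pos.2 hx₁R))).exists
    exact ⟨t, h2, h3, h5, h1⟩
  have hlower : η * (6 * t ^ 2) ≤ secondDiff t (softPot ε ρ) x₁ := by
    have hs : ∀ i : Fin 3, ‖(EuclideanSpace.single i t : E3)‖ = t := fun i => by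
      rw [PiLp.norm_single, Real.norm_of_nonneg ht0.le]
    rw [← secondDiff_norm_sq t x₁]
    unfold secondDiff
    rw [Finset.mul_sum]
    refine Finset.sum_le_sum fun i _ => ?_
    have h1 : softPot ε ρ x₁ - η * ‖x₁‖ ^ 2 ≤ softPot ε ρ (x₁ + EuclideanSpace.single i t)
        - η * ‖x₁ + EuclideanSpace.single i t‖ ^ 2 :=
      hmin (by
        rw [mem_closedBall_zero_iff]
        linarith [norm_add_le x₁ (EuclideanSpace.single i t), hs i])
    have h2 : softPot ε ρ x₁ - η * ‖x₁‖ ^ 2 ≤ softPot ε ρ (x₁ - EuclideanSpace.single i t)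
        - η * ‖x₁ - EuclideanSpace.single i t‖ ^ 2 :=
      hmin (by
        rw [mem_closedBall_zero_iff]
        linarith [norm_sub_le x₁ (EuclideanSpace.single i t), hs i])
    linarith
  have hupper := hρ.secondDiff_softPot_le ht0 (by linarith : 6 * t ≤ ε) hδ hball
  have hfac : M * (165 * t ^ 3 / ε ^ 4 + 3 * t ^ 2 * ε ^ 2 / δ ^ 5)
      = t ^ 2 * (M * (165 * t / ε ^ 4) + M * (3 * ε ^ 2 / δ ^ 5)) := by
    field_simp
  have h1 : t ^ 2 * (M * (165 * t / ε ^ 4) + M * (3 * ε ^ 2 / δ ^ 5)) < t ^ 2 * (2 * η) := by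
    gcongr
    linarith
  have h2 : 4 * π * (η * (6 * t ^ 2)) ≤ 4 * π * secondDiff t (softPot ε ρ) x₁ := by gcongr
  have h3 : t ^ 2 * (2 * η) ≤ 4 * π * (η * (6 * t ^ 2)) := by
    have : 0 < t ^ 2 * η := by positivity
    nlinarith [Real.pi_gt_three]
  rw [← hMdef, hfac] at hupper
  linarith

end Density

/-- The mutual Coulomb energy of two uniformly charged sets. -/
def mutualEnergy (A B : Set E3) : ℝ := ∫ x in A, ∫ y in B, coul x y

lemma energy_eq (A B : Set E3) :
    energy A B = mutualEnergy A A + mutualEnergy B B - 2 * mutualEnergy A B := rfl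

lemma isDensity_indicator {A : Set E3} (hA : MeasurableSet A) (hA' : volume A < ⊤) :
    IsDensity (A.indicator fun _ => (1 : ℝ)) where
  integrable := (integrable_indicator_iff hA).2 (integrableOn_const hA'.ne)
  abs_le_one y := by by_cases hy : y ∈ A <;> simp [hy]

lemma indicator_one_mul_coul (A : Set E3) (x y : E3) :
    A.indicator (fun _ => (1 : ℝ)) y * coul x y = A.indicator (coul x) y := by
  by_cases hy : y ∈ A <;> simp [hy]

lemma chargePot_indicator {A : Set E3} (hA : MeasurableSet A) (x : E3) :
    chargePot (A.indicator fun _ => (1 : ℝ)) x = ∫ y in A, coul x y := by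
  simp only [chargePot, indicator_one_mul_coul, integral_indicator hA]

section MutualEnergy

variable {A B C : Set E3}

lemma integrableOn_coul (hA : MeasurableSet A) (hA' : volume A < ⊤) (x : E3) :
    IntegrableOn (coul x) A := by
  rw [← integrable_indicator_iff hA]
  simpa only [indicator_one_mul_coul] using (isDensity_indicator hA hA').integrable_mul_coul x

lemma integrableOn_setIntegral_coul (hA' : volume A < ⊤)
    (hB : MeasurableSet B) (hB' : volume B < ⊤) :
    IntegrableOn (fun x => ∫ y in B, coul x y) A := by
  simp only [← chargePot_indicator hB]
  exact Measure.integrableOn_of_bounded hA'.ne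
    (isDensity_indicator hB hB').continuous_chargePot.aestronglyMeasurable
    (Eventually.of_forall fun x => (isDensity_indicator hB hB').abs_chargePot_le one_pos x)

lemma mutualEnergy_comm (hA' : volume A < ⊤)
    (hB : MeasurableSet B) (hB' : volume B < ⊤) :
    mutualEnergy A B = mutualEnergy B A := by
  have h : Integrable (Function.uncurry coul) ((volume.restrict A).prod (volume.restrict B)) := by
    rw [integrable_prod_iff measurable_coul.aestronglyMeasurable]
    refine ⟨Eventually.of_forall fun x => integrableOn_coul hB hB' x, ?_⟩
    simp only [Function.uncurry, Real.norm_of_nonneg (coul_nonneg _ _)]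
    exact integrableOn_setIntegral_coul hA' hB hB'
  unfold mutualEnergy
  rw [integral_integral_swap h]
  simp_rw [coul_comm]

lemma mutualEnergy_union_left (hd : Disjoint A B) (hA' : volume A < ⊤) (hB : MeasurableSet B)
    (hB' : volume B < ⊤) (hC : MeasurableSet C) (hC' : volume C < ⊤) :
    mutualEnergy (A ∪ B) C = mutualEnergy A C + mutualEnergy B C :=
  setIntegral_union hd hB (integrableOn_setIntegral_coul hA' hC hC')
    (integrableOn_setIntegral_coul hB' hC hC')

lemma mutualEnergy_union_right (hd : Disjoint A B) (hA : MeasurableSet A) (hA' : volume A < ⊤)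
    (hB : MeasurableSet B) (hB' : volume B < ⊤) (hC : MeasurableSet C) (hC' : volume C < ⊤) :
    mutualEnergy C (A ∪ B) = mutualEnergy C A + mutualEnergy C B := by
  have hU : volume (A ∪ B) < ⊤ := measure_union_lt_top hA' hB'
  rw [mutualEnergy_comm hC' (hA.union hB) hU, mutualEnergy_union_left hd hA' hB hB' hC hC',
    mutualEnergy_comm hA' hC hC', mutualEnergy_comm hB' hC hC']

lemma energy_union (hd : Disjoint A B) (hA : MeasurableSet A) (hA' : volume A < ⊤)
    (hB : MeasurableSet B) (hB' : volume B < ⊤) (hC : MeasurableSet C) (hC' : volume C < ⊤) :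
    energy C (A ∪ B) = energy C A + mutualEnergy B B + 2 * mutualEnergy B A
      - 2 * mutualEnergy B C := by
  have hU : volume (A ∪ B) < ⊤ := measure_union_lt_top hA' hB'
  rw [energy_eq, energy_eq, mutualEnergy_union_left hd hA' hB hB' (hA.union hB) hU,
    mutualEnergy_union_right hd hA hA' hB hB' hA hA',
    mutualEnergy_union_right hd hA hA' hB hB' hB hB',
    mutualEnergy_union_right hd hA hA' hB hB' hC hC',
    mutualEnergy_comm hA' hB hB', mutualEnergy_comm hC' hB hB']
  ring

lemma potential_eq (hA : MeasurableSet A) (hA' : volume A < ⊤) (hB : MeasurableSet B)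
    (hB' : volume B < ⊤) (x : E3) :
    potential A B x = (∫ y in A, coul x y) - ∫ y in B, coul x y := by
  rw [← chargePot_indicator hA, ← chargePot_indicator hB]
  unfold potential chargePot
  rw [← integral_sub ((isDensity_indicator hA hA').integrable_mul_coul x)
    ((isDensity_indicator hB hB').integrable_mul_coul x)]
  simp only [sub_mul]

lemma setIntegral_potential (hA : MeasurableSet A) (hA' : volume A < ⊤) (hB : MeasurableSet B)
    (hB' : volume B < ⊤) (hC' : volume C < ⊤) :
    ∫ x in C, potential A B x = mutualEnergy C A - mutualEnergy C B := by
  simp only [potential_eq hA hA' hB hB']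
  exact integral_sub (integrableOn_setIntegral_coul hC' hA hA')
    (integrableOn_setIntegral_coul hC' hB hB')

lemma mutualEnergy_self_le {x₀ : E3} {r : ℝ} (hr : 0 ≤ r) (hA : MeasurableSet A)
    (hAr : A ⊆ ball x₀ r) : mutualEnergy A A ≤ 2 * r ^ 2 * volume.real A := by
  have hA' : volume A < ⊤ := (measure_mono hAr).trans_lt measure_ball_lt_top
  have h : ∀ x ∈ A, ∫ y in A, coul x y ≤ 2 * r ^ 2 := fun x hx => by
    have hsub : A ⊆ ball x (2 * r) := fun y hy => by
      have h1 := mem_ball.1 (hAr hx)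
      have h2 := mem_ball.1 (hAr hy)
      have h3 := dist_triangle_right y x x₀
      rw [mem_ball]
      linarith
    calc ∫ y in A, coul x y ≤ ∫ y in ball x (2 * r), coul x y :=
          setIntegral_mono_set (integrableOn_coul_ball x _)
            (Eventually.of_forall fun y => coul_nonneg x y) hsub.eventuallyLE
      _ = 2 * r ^ 2 := by rw [setIntegral_coul_ball x (by positivity)]; ring
  calc mutualEnergy A A ≤ ∫ _x in A, 2 * r ^ 2 :=
        setIntegral_mono_on (integrableOn_setIntegral_coul hA' hA hA')
          (integrableOn_const hA'.ne) hA h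
    _ = 2 * r ^ 2 * volume.real A := by rw [setIntegral_const, smul_eq_mul, mul_comm]

end MutualEnergy

lemma measure_inter_pos_eq_zero {f : E3 → ℝ} (hf : Continuous f) {S : Set E3}
    (hS : MeasurableSet S)
    (h : ∀ A ⊆ S, MeasurableSet A → volume A < ⊤ → 2 * ∫ x in A, f x ≤ mutualEnergy A A) :
    volume (S ∩ {x | 0 < f x}) = 0 := by
  refine measure_null_of_locally_null _ fun x₀ hx₀ => ?_
  have hc : 0 < f x₀ := hx₀.2
  obtain ⟨r₁, hr₁, hfr⟩ := Metric.isOpen_iff.1 (isOpen_lt continuous_const hf) x₀ (half_lt_self hc)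
  obtain ⟨r, hr, hrr₁, hrc⟩ : ∃ r, 0 < r ∧ r ≤ r₁ ∧ 2 * r ^ 2 < f x₀ := by
    have hlim : Tendsto (fun r : ℝ => 2 * r ^ 2) (𝓝[>] 0) (𝓝 0) := by
      have : Continuous fun r : ℝ => 2 * r ^ 2 := by fun_prop
      simpa using (this.tendsto 0).mono_left nhdsWithin_le_nhds
    obtain ⟨r, h1, h2, h3⟩ := ((hlim.eventually (gt_mem_nhds hc)).and
      (Ioc_mem_nhdsGT hr₁)).exists
    exact ⟨r, h2, h3, h1⟩
  refine ⟨S ∩ ball x₀ r, ?_, ?_⟩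
  · exact inter_mem (mem_of_superset self_mem_nhdsWithin inter_subset_left)
      (mem_nhdsWithin_of_mem_nhds (ball_mem_nhds x₀ hr))
  have hA : MeasurableSet (S ∩ ball x₀ r) := hS.inter measurableSet_ball
  have hA' : volume (S ∩ ball x₀ r) < ⊤ :=
    (measure_mono inter_subset_right).trans_lt measure_ball_lt_top
  have h1 := h _ inter_subset_left hA hA'
  have h2 := mutualEnergy_self_le hr.le hA inter_subset_right
  have h3 : f x₀ / 2 * volume.real (S ∩ ball x₀ r) ≤ ∫ x in S ∩ ball x₀ r, f x := by
    rw [mul_comm, ← smul_eq_mul, ← setIntegral_const]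
    refine setIntegral_mono_on (integrableOn_const hA'.ne) ?_ hA
      fun x hx => (hfr (ball_subset_ball hrr₁ hx.2)).le
    exact (hf.continuousOn.integrableOn_compact (isCompact_closedBall x₀ r)).mono_set
      (inter_subset_right.trans ball_subset_closedBall)
  have h4 : volume.real (S ∩ ball x₀ r) = 0 := by
    have := measureReal_nonneg (μ := volume) (s := S ∩ ball x₀ r)
    nlinarith
  exact (measureReal_eq_zero_iff hA'.ne).1 h4

/-- **Theorem 2.3** (Screening): the potential of a minimizer of the
unconstrained problem is nonnegative and vanishes a.e. outside `Ω⁺ ∪ Ω⁻`. -/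
theorem screening
    (Ωp : Set E3) (ho : IsOpen Ωp) (hb : Bornology.IsBounded Ωp)
    (hlip : HasLipschitzBoundary Ωp)
    (Ωm : Set E3) (hadm : Adm Ωp Ωm)
    (hmin : ∀ A, Adm Ωp A → energy Ωp Ωm ≤ energy Ωp A) :
    (∀ x, 0 ≤ potential Ωp Ωm x) ∧
      (∀ᵐ x ∂(volume.restrict (Ωp ∪ Ωm)ᶜ), potential Ωp Ωm x = 0) := by
  obtain ⟨hm, hnull, hfin⟩ := hadm
  have hp : MeasurableSet Ωp := ho.measurableSet
  have hp' : volume Ωp < ⊤ := hb.measure_lt_top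
  have hρ : IsDensity fun y =>
      Set.indicator Ωp (fun _ => (1 : ℝ)) y - Set.indicator Ωm (fun _ => (1 : ℝ)) y :=
    ⟨(isDensity_indicator hp hp').integrable.sub (isDensity_indicator hm hfin).integrable,
      fun y => by by_cases h1 : y ∈ Ωp <;> by_cases h2 : y ∈ Ωm <;> simp [h1, h2]⟩
  have hcont : Continuous (potential Ωp Ωm) := hρ.continuous_chargePot
  have hadd : volume ((Ωp ∪ Ωm)ᶜ ∩ {x | 0 < potential Ωp Ωm x}) = 0 := by
    refine measure_inter_pos_eq_zero hcont (hp.union hm).compl fun A hAS hA hA' => ?_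
    have hdp : Disjoint Ωp A :=
      disjoint_compl_right.mono subset_union_left hAS
    have hdm : Disjoint Ωm A :=
      disjoint_compl_right.mono subset_union_right hAS
    have h1 := hmin (Ωm ∪ A) ⟨hm.union hA, by
      rw [inter_union_distrib_left, hdp.inter_eq, union_empty, hnull],
      measure_union_lt_top hfin hA'⟩
    rw [energy_union hdm hm hfin hA hA' hp hp'] at h1
    rw [setIntegral_potential hp hp' hm hfin hA']
    linarith
  have hremove : volume (Ωm ∩ {x | 0 < -potential Ωp Ωm x}) = 0 := by
    refine measure_inter_pos_eq_zero hcont.neg hm fun A hAS hA hA' => ?_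
    have hD : MeasurableSet (Ωm \ A) := hm.diff hA
    have hD' : volume (Ωm \ A) < ⊤ := (measure_mono sdiff_subset).trans_lt hfin
    have h1 := hmin (Ωm \ A) ⟨hD,
      measure_mono_null (inter_subset_inter_right _ sdiff_subset) hnull, hD'⟩
    have hU : Ωm \ A ∪ A = Ωm := sdiff_union_of_subset hAS
    have h2 := energy_union disjoint_sdiff_left hD hD' hA hA' hp hp'
    have h3 := mutualEnergy_union_right disjoint_sdiff_left hD hD' hA hA' hA hA'
    rw [hU] at h2 h3
    simp only [Pi.neg_apply]
    rw [integral_neg, setIntegral_potential hp hp' hm hfin hA']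
    linarith
  have hnonneg : ∀ x, 0 ≤ potential Ωp Ωm x := by
    refine hρ.chargePot_nonneg ?_
    filter_upwards [compl_mem_ae_iff.2 hremove] with y hy hneg
    have hym : y ∉ Ωm := fun h => hy ⟨h, neg_pos.2 hneg⟩
    rw [indicator_of_notMem hym, sub_zero]
    exact indicator_nonneg (fun _ _ => zero_le_one) y
  refine ⟨hnonneg, ?_⟩
  rw [ae_restrict_iff' (hp.union hm).compl]
  filter_upwards [compl_mem_ae_iff.2 hadd] with x hx hxS
  exact le_antisymm (not_lt.1 fun h => hx ⟨hxS, h⟩) (hnonneg x)
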